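/- arXiv:0905.3696 — 2 statements merged into one kernel-verified Lean document; each statement's English description precedes it below -/
import Mathlib

section
/- For an n-tilting right R-module T with endomorphism ring S, given any exact sequence 0 → R → T_0 → T_1 → ... → T_m → 0 where each T_i is a direct summand of a (possibly infinite) direct sum of copies of T, there exists an exact sequence 0 → R → T'_0 → T'_1 → ... → T'_n → 0 where T'_0 = T_0 ⊕ T_1^(ω) ⊕ ... ⊕ T_n^(ω) and each subsequent term is a countable direct sum of the T_i's; consequently T' := T_0 ⊕ T_1^(ω) ⊕ ... ⊕ T_n^(ω) is a 'good' n-tilting module equivalent to T, i.e. Gen_n(T') = Gen_n(T) and T' satisfies (T3') with summands of finite direct sums of copies of T'. -/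
open CategoryTheory CategoryTheory.Limits

/-- the `n`-th Ext group `Ext^n_A(M,N)` (as a `ℤ`-module). -/
noncomputable def extRT (A : Type) [Ring A] (n : ℕ) (M N : ModuleCat A) : ModuleCat ℤ :=
  ((Ext ℤ (ModuleCat A) n).obj (Opposite.op M)).obj N
section Tilting

variable (R : Type) [Ring R]

/-- `X` is a direct summand of a direct sum of copies of `T`. -/
def IsSummandOfCopies (T X : Type) [AddCommGroup T] [Module R T]
    [AddCommGroup X] [Module R X] : Prop :=
  ∃ (α : Type) (s : X →ₗ[R] (α →₀ T)) (r : (α →₀ T) →ₗ[R] X), r ∘ₗ s = LinearMap.id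

/-- `X` is a direct summand of a finite direct sum of copies of `T`. -/
def IsSummandOfFinCopies (T X : Type) [AddCommGroup T] [Module R T]
    [AddCommGroup X] [Module R X] : Prop :=
  ∃ (k : ℕ) (s : X →ₗ[R] (Fin k → T)) (r : (Fin k → T) →ₗ[R] X), r ∘ₗ s = LinearMap.id

/-- `T` is an `n`-tilting module: (T1) it admits a projective resolution of length `n`,
(T2) `Ext^i_R(T, T^{(α)}) = 0` for `i > 0` and all cardinals `α`, and (T3) there is an
exact coresolution `0 → R → T_0 → ⋯ → T_m → 0` with each `T_i ∈ Add(T)`. -/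
structure IsNTilting (n : ℕ) (T : ModuleCat R) : Prop where
  t1 : ∃ P : ProjectiveResolution T, ∀ i, n < i → IsZero (P.complex.X i)
  t2 : ∀ i : ℕ, 0 < i → ∀ α : Type,
      Subsingleton (extRT R i T (ModuleCat.of R (α →₀ T)))
  t3 : ∃ (m : ℕ) (Tc : ℕ → ModuleCat R) (g : ∀ i, Tc i ⟶ Tc (i + 1))
      (ι : R →ₗ[R] Tc 0),
      Function.Injective ι ∧ Function.Exact ι (g 0) ∧
      (∀ i, Function.Exact (g i) (g (i + 1))) ∧
      (∀ i, i ≤ m → IsSummandOfCopies R T (Tc i)) ∧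
      (∀ i, m < i → Subsingleton (Tc i))

/-- `T` is a good `n`-tilting module: (T1), (T2) and (T3'): there is an exact
coresolution `0 → R → T_0 → ⋯ → T_n → 0` whose terms are direct summands of finite
direct sums of copies of `T`. -/
structure IsGoodNTilting (n : ℕ) (T : ModuleCat R) : Prop where
  t1 : ∃ P : ProjectiveResolution T, ∀ i, n < i → IsZero (P.complex.X i)
  t2 : ∀ i : ℕ, 0 < i → ∀ α : Type,
      Subsingleton (extRT R i T (ModuleCat.of R (α →₀ T)))
  t3' : ∃ (Tc : ℕ → ModuleCat R) (g : ∀ i, Tc i ⟶ Tc (i + 1))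
      (ι : R →ₗ[R] Tc 0),
      Function.Injective ι ∧ Function.Exact ι (g 0) ∧
      (∀ i, Function.Exact (g i) (g (i + 1))) ∧
      (∀ i, i ≤ n → IsSummandOfFinCopies R T (Tc i)) ∧
      (∀ i, n < i → Subsingleton (Tc i))

end Tilting

/-- `M ∈ Gen_n(T)`: there is an exact sequence
`T^{(α_n)} → ⋯ → T^{(α_1)} → M → 0`. -/
def GenN (R : Type) [Ring R] (n : ℕ) (T : Type) [AddCommGroup T] [Module R T]
    (M : ModuleCat R) : Prop :=
  ∃ (W : ℕ → ModuleCat R) (d : ∀ i, W (i + 1) ⟶ W i),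
    W 0 = M ∧
    (∀ i, 1 ≤ i → i ≤ n → ∃ α : Type, Nonempty (W i ≅ ModuleCat.of R (α →₀ T))) ∧
    Function.Surjective (d 0) ∧
    (∀ i, i + 2 ≤ n → Function.Exact (d (i + 1)) (d i))

section DimensionShifting

variable {R : Type} [Ring R]

lemma shortExact_of_linearMap {A B C : Type} [AddCommGroup A] [Module R A] [AddCommGroup B]
    [Module R B] [AddCommGroup C] [Module R C] (f : A →ₗ[R] B) (g : B →ₗ[R] C)
    (hf : Function.Injective f) (hfg : Function.Exact f g) (hg : Function.Surjective g) :
    (ShortComplex.mk (ModuleCat.ofHom f) (ModuleCat.ofHom g)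
      (ModuleCat.hom_ext hfg.linearMap_comp_eq_zero)).ShortExact where
  exact := (ShortComplex.ShortExact.moduleCat_exact_iff_function_exact _).2 hfg
  mono_f := (ModuleCat.mono_iff_injective _).2 hf
  epi_g := (ModuleCat.epi_iff_surjective _).2 hg

lemma shortExact_ker_range {A B : Type} [AddCommGroup A] [Module R A] [AddCommGroup B]
    [Module R B] (f : A →ₗ[R] B) :
    (ShortComplex.mk (ModuleCat.ofHom f.ker.subtype) (ModuleCat.ofHom f.rangeRestrict)
      (ModuleCat.hom_ext (by ext x; exact x.2))).ShortExact :=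
  shortExact_of_linearMap _ _ f.ker.injective_subtype
    (by rw [LinearMap.exact_iff]; simp) f.surjective_rangeRestrict

variable {S : ShortComplex (ModuleCat.{0} R)}

lemma subsingleton_abelianExt_X₃ (hS : S.ShortExact) (X : ModuleCat.{0} R) (i : ℕ)
    (h₂ : Subsingleton (Abelian.Ext X S.X₂ i)) (h₁ : Subsingleton (Abelian.Ext X S.X₁ (i + 1))) :
    Subsingleton (Abelian.Ext X S.X₃ i) := by
  refine subsingleton_of_forall_eq 0 fun x ↦ ?_
  obtain ⟨y, rfl⟩ := Abelian.Ext.covariant_sequence_exact₃ X hS x rfl (Subsingleton.elim _ _)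
  rw [Subsingleton.elim y 0, Abelian.Ext.zero_comp]

lemma subsingleton_abelianExt_X₁ (hS : S.ShortExact) (X : ModuleCat.{0} R) (i : ℕ)
    (h₂ : Subsingleton (Abelian.Ext X S.X₂ (i + 1))) (h₃ : Subsingleton (Abelian.Ext X S.X₃ i)) :
    Subsingleton (Abelian.Ext X S.X₁ (i + 1)) := by
  refine subsingleton_of_forall_eq 0 fun x ↦ ?_
  obtain ⟨y, rfl⟩ := Abelian.Ext.covariant_sequence_exact₁ X hS x (Subsingleton.elim _ _) rfl
  rw [Subsingleton.elim y 0, Abelian.Ext.zero_comp]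

/-- If `Hom(X, S.X₂) → Hom(X, S.X₃)` is surjective and `Ext^1(X, S.X₂) = 0`,
then `Ext^1(X, S.X₁) = 0`. -/
lemma subsingleton_abelianExt_one_X₁ (hS : S.ShortExact) (X : ModuleCat.{0} R)
    (h₂ : Subsingleton (Abelian.Ext X S.X₂ 1))
    (h₃ : ∀ f : X ⟶ S.X₃, ∃ g : X ⟶ S.X₂, g ≫ S.g = f) :
    Subsingleton (Abelian.Ext X S.X₁ 1) := by
  refine subsingleton_of_forall_eq 0 fun x ↦ ?_
  obtain ⟨y, rfl⟩ := Abelian.Ext.covariant_sequence_exact₁ X hS x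
    (Subsingleton.elim _ _) (zero_add 1)
  obtain ⟨f, rfl⟩ := Abelian.Ext.homEquiv₀.symm.surjective y
  obtain ⟨g, rfl⟩ := h₃ f
  have : Abelian.Ext.homEquiv₀.symm (g ≫ S.g) =
      (Abelian.Ext.mk₀ g).comp (Abelian.Ext.mk₀ S.g) (zero_add 0) := by simp
  rw [this, Abelian.Ext.comp_assoc_of_second_deg_zero,
    hS.comp_extClass, Abelian.Ext.comp_zero]

lemma subsingleton_abelianExt_X₁_left (hS : S.ShortExact) (N : ModuleCat.{0} R) (i : ℕ)
    (h₂ : Subsingleton (Abelian.Ext S.X₂ N i)) (h₃ : Subsingleton (Abelian.Ext S.X₃ N (i + 1))) :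
    Subsingleton (Abelian.Ext S.X₁ N i) := by
  refine subsingleton_of_forall_eq 0 fun x ↦ ?_
  obtain ⟨y, rfl⟩ := Abelian.Ext.contravariant_sequence_exact₁ hS N x (add_comm 1 i)
    (Subsingleton.elim _ _)
  rw [Subsingleton.elim y 0, Abelian.Ext.comp_zero]

lemma exists_extension_of_subsingleton_abelianExt (hS : S.ShortExact)
    (N : ModuleCat.{0} R) (h₃ : Subsingleton (Abelian.Ext S.X₃ N 1)) (f : S.X₁ ⟶ N) :
    ∃ g : S.X₂ ⟶ N, S.f ≫ g = f := by
  obtain ⟨y, hy⟩ := Abelian.Ext.contravariant_sequence_exact₁ hS N (Abelian.Ext.mk₀ f)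
    (add_zero 1) (Subsingleton.elim _ _)
  obtain ⟨g, rfl⟩ := Abelian.Ext.homEquiv₀.symm.surjective y
  exact ⟨g, Abelian.Ext.homEquiv₀.symm.injective (by simpa using hy)⟩

end DimensionShifting

section ExtVanishing

variable {R : Type} [Ring R]

/-- Vanishing of the derived-functor Ext, in terms of cocycles of a projective resolution. -/
lemma subsingleton_extRT_succ_iff {M : ModuleCat.{0} R} (P : ProjectiveResolution M)
    (N : ModuleCat.{0} R) (i : ℕ) :
    Subsingleton (extRT R (i + 1) M N) ↔
      ∀ f : P.complex.X (i + 1) ⟶ N, P.complex.d (i + 2) (i + 1) ≫ f = 0 →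
        ∃ g : P.complex.X i ⟶ N, P.complex.d (i + 1) i ≫ g = f := by
  rw [← ModuleCat.isZero_iff_subsingleton, extRT, (P.isoExt (R := ℤ) (i + 1) N).isZero_iff,
    ← HomologicalComplex.exactAt_iff_isZero_homology,
    HomologicalComplex.exactAt_iff' _ i (i + 1) (i + 2) (by simp) (by simp),
    ShortComplex.moduleCat_exact_iff]
  exact Iff.rfl

lemma subsingleton_abelianExt_succ_iff {M : ModuleCat.{0} R} (P : ProjectiveResolution M)
    (N : ModuleCat.{0} R) (i : ℕ) :
    Subsingleton (Abelian.Ext M N (i + 1)) ↔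
      ∀ f : P.complex.X (i + 1) ⟶ N, P.complex.d (i + 2) (i + 1) ≫ f = 0 →
        ∃ g : P.complex.X i ⟶ N, P.complex.d (i + 1) i ≫ g = f := by
  constructor
  · intro h f hf
    exact (P.extMk_eq_zero_iff f (i + 2) rfl hf i rfl).1 (Subsingleton.elim _ _)
  · refine fun h ↦ subsingleton_of_forall_eq 0 fun x ↦ ?_
    obtain ⟨f, hf, rfl⟩ := P.extMk_surjective x (i + 2) rfl
    exact (P.extMk_eq_zero_iff f (i + 2) rfl hf i rfl).2 (h f hf)

lemma subsingleton_extRT_iff (M N : ModuleCat.{0} R) {i : ℕ} (hi : 0 < i) :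
    Subsingleton (extRT R i M N) ↔ Subsingleton (Abelian.Ext M N i) := by
  obtain ⟨i, rfl⟩ := Nat.exists_eq_add_of_lt hi
  simp only [Nat.zero_add]
  rw [subsingleton_extRT_succ_iff (ProjectiveResolution.of M),
    subsingleton_abelianExt_succ_iff (ProjectiveResolution.of M)]

lemma hasProjectiveDimensionLT_of_projectiveResolution {M : ModuleCat.{0} R}
    (P : ProjectiveResolution M) (n : ℕ) (hP : ∀ i, n < i → IsZero (P.complex.X i)) :
    HasProjectiveDimensionLT M (n + 1) := by
  rw [hasProjectiveDimensionLT_iff]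
  intro i hi N e
  obtain ⟨f, hf, rfl⟩ := P.extMk_surjective e (i + 1) rfl
  obtain rfl : f = 0 := (hP i hi).eq_of_src _ _
  exact P.extMk_zero _ rfl

lemma subsingleton_abelianExt_of_retract {X X' : ModuleCat.{0} R} (h : Retract X X')
    (N : ModuleCat.{0} R) (i : ℕ) [Subsingleton (Abelian.Ext X' N i)] :
    Subsingleton (Abelian.Ext X N i) := by
  refine subsingleton_of_forall_eq 0 fun x ↦ ?_
  rw [← x.mk₀_id_comp, ← h.retract, ← Abelian.Ext.mk₀_comp_mk₀,
    Abelian.Ext.comp_assoc_of_second_deg_zero,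
    Subsingleton.elim ((Abelian.Ext.mk₀ h.r).comp x (zero_add i)) 0, Abelian.Ext.comp_zero]

lemma subsingleton_abelianExt_of_retract_right (X : ModuleCat.{0} R) {N N' : ModuleCat.{0} R}
    (h : Retract N N') (i : ℕ) [Subsingleton (Abelian.Ext X N' i)] :
    Subsingleton (Abelian.Ext X N i) := by
  refine subsingleton_of_forall_eq 0 fun x ↦ ?_
  rw [← x.comp_mk₀_id, ← h.retract, ← Abelian.Ext.mk₀_comp_mk₀,
    ← Abelian.Ext.comp_assoc_of_third_deg_zero,
    Subsingleton.elim (x.comp (Abelian.Ext.mk₀ h.i) (add_zero i)) 0, Abelian.Ext.zero_comp]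

/-- `Ext^1(X, N)` vanishes if and only if, for an embedding of `N` into an injective, every map
from `X` to the cokernel lifts. -/
lemma subsingleton_abelianExt_one_iff (X : ModuleCat.{0} R) {S : ShortComplex (ModuleCat.{0} R)}
    (hS : S.ShortExact) [Injective S.X₂] :
    Subsingleton (Abelian.Ext X S.X₁ 1) ↔ ∀ f : X ⟶ S.X₃, ∃ g : X ⟶ S.X₂, g ≫ S.g = f := by
  constructor
  · intro h f
    obtain ⟨x, hx⟩ := Abelian.Ext.covariant_sequence_exact₃ X hS (Abelian.Ext.mk₀ f)
      (zero_add 1) (Subsingleton.elim _ _)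
    obtain ⟨g, rfl⟩ := Abelian.Ext.homEquiv₀.symm.surjective x
    exact ⟨g, Abelian.Ext.homEquiv₀.symm.injective (by simpa using hx)⟩
  · exact subsingleton_abelianExt_one_X₁ hS X
      (subsingleton_of_forall_eq 0 fun x ↦ x.eq_zero_of_injective)

lemma subsingleton_abelianExt_succ_succ_iff (X : ModuleCat.{0} R)
    {S : ShortComplex (ModuleCat.{0} R)} (hS : S.ShortExact) [Injective S.X₂] (i : ℕ) :
    Subsingleton (Abelian.Ext X S.X₁ (i + 2)) ↔ Subsingleton (Abelian.Ext X S.X₃ (i + 1)) := by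
  have h₂ (j : ℕ) : Subsingleton (Abelian.Ext X S.X₂ (j + 1)) :=
    subsingleton_of_forall_eq 0 fun x ↦ x.eq_zero_of_injective
  exact ⟨subsingleton_abelianExt_X₃ hS X (i + 1) (h₂ i),
    subsingleton_abelianExt_X₁ hS X (i + 1) (h₂ (i + 1))⟩

lemma exists_lift_finsupp (T : Type) [AddCommGroup T] [Module R T] (β : Type)
    {M N : ModuleCat.{0} R} (p : M ⟶ N)
    (h : ∀ f : ModuleCat.of R T ⟶ N, ∃ g : ModuleCat.of R T ⟶ M, g ≫ p = f)
    (f : ModuleCat.of R (β →₀ T) ⟶ N) : ∃ g : ModuleCat.of R (β →₀ T) ⟶ M, g ≫ p = f := by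
  choose g hg using fun b : β ↦ h (ModuleCat.ofHom (f.hom ∘ₗ Finsupp.lsingle b))
  refine ⟨ModuleCat.ofHom (Finsupp.lsum ℕ fun b ↦ (g b).hom), ?_⟩
  ext b t
  simpa using ConcreteCategory.congr_hom (hg b) t

lemma subsingleton_abelianExt_finsupp (T : Type) [AddCommGroup T] [Module R T] (β : Type)
    (N : ModuleCat.{0} R) (i : ℕ)
    (h : Subsingleton (Abelian.Ext (ModuleCat.of R T) N (i + 1))) :
    Subsingleton (Abelian.Ext (ModuleCat.of R (β →₀ T)) N (i + 1)) := by
  induction i generalizing N with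
  | zero =>
    let S := ShortComplex.mk _ _ (cokernel.condition (Injective.ι N))
    have hS : S.ShortExact :=
      { exact := ShortComplex.exact_of_g_is_cokernel _ (cokernelIsCokernel S.f) }
    have : Injective S.X₂ := inferInstanceAs (Injective (Injective.under N))
    exact (subsingleton_abelianExt_one_iff _ hS).2
      (exists_lift_finsupp T β S.g ((subsingleton_abelianExt_one_iff _ hS).1 h))
  | succ i ih =>
    let S := ShortComplex.mk _ _ (cokernel.condition (Injective.ι N))
    have hS : S.ShortExact :=
      { exact := ShortComplex.exact_of_g_is_cokernel _ (cokernelIsCokernel S.f) }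
    have : Injective S.X₂ := inferInstanceAs (Injective (Injective.under N))
    exact (subsingleton_abelianExt_succ_succ_iff _ hS i).2
      (ih _ ((subsingleton_abelianExt_succ_succ_iff _ hS i).1 h))

end ExtVanishing

section Perpendicular

variable {R : Type} [Ring R]

/-- `M` lies in the right Ext-perpendicular class of `X`. -/
def ExtPerp (X M : ModuleCat.{0} R) : Prop :=
  ∀ i : ℕ, Subsingleton (Abelian.Ext X M (i + 1))

lemma IsSummandOfCopies.extPerp {T X : Type} [AddCommGroup T] [Module R T] [AddCommGroup X]
    [Module R X] (h : IsSummandOfCopies R T X) {M : ModuleCat.{0} R}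
    (hM : ExtPerp (ModuleCat.of R T) M) : ExtPerp (ModuleCat.of R X) M := by
  obtain ⟨α, s, r, hsr⟩ := h
  intro i
  have := subsingleton_abelianExt_finsupp T α M i (hM i)
  exact subsingleton_abelianExt_of_retract
    (⟨ModuleCat.ofHom s, ModuleCat.ofHom r, ModuleCat.hom_ext hsr⟩ :
      Retract (ModuleCat.of R X) (ModuleCat.of R (α →₀ T))) M (i + 1)

lemma IsSummandOfCopies.extPerp_right {T X : Type} [AddCommGroup T] [Module R T]
    [AddCommGroup X] [Module R X] (h : IsSummandOfCopies R T X) {Y : ModuleCat.{0} R}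
    (hY : ∀ α : Type, ExtPerp Y (ModuleCat.of R (α →₀ T))) : ExtPerp Y (ModuleCat.of R X) := by
  obtain ⟨α, s, r, hsr⟩ := h
  intro i
  have := hY α i
  exact subsingleton_abelianExt_of_retract_right Y
    (⟨ModuleCat.ofHom s, ModuleCat.ofHom r, ModuleCat.hom_ext hsr⟩ :
      Retract (ModuleCat.of R X) (ModuleCat.of R (α →₀ T))) (i + 1)

lemma IsSummandOfCopies.hasProjectiveDimensionLT {T X : Type} [AddCommGroup T] [Module R T]
    [AddCommGroup X] [Module R X] (h : IsSummandOfCopies R T X) (n : ℕ)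
    [HasProjectiveDimensionLT (ModuleCat.of R T) (n + 1)] :
    HasProjectiveDimensionLT (ModuleCat.of R X) (n + 1) := by
  obtain ⟨α, s, r, hsr⟩ := h
  have : HasProjectiveDimensionLT (ModuleCat.of R (α →₀ T)) (n + 1) := by
    rw [hasProjectiveDimensionLT_iff]
    intro i hi N e
    obtain ⟨i, rfl⟩ : ∃ j, i = j + 1 := ⟨i - 1, by lia⟩
    have := subsingleton_abelianExt_finsupp T α N i
      (HasProjectiveDimensionLT.subsingleton _ (n + 1) _ hi _)
    exact Subsingleton.elim _ _
  exact (⟨ModuleCat.ofHom s, ModuleCat.ofHom r, ModuleCat.hom_ext hsr⟩ :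
      Retract (ModuleCat.of R X) (ModuleCat.of R (α →₀ T))).hasProjectiveDimensionLT (n + 1)

/-- If `X` has projective dimension at most `n`, a module with a presentation of length `n` by
modules in the perpendicular class of `X` is itself in that class. -/
lemma extPerp_of_exact {X : ModuleCat.{0} R} {n : ℕ} [HasProjectiveDimensionLT X (n + 1)]
    (W : ℕ → ModuleCat.{0} R) (d : ∀ i, W (i + 1) ⟶ W i)
    (hW : ∀ i, 1 ≤ i → i ≤ n → ExtPerp X (W i)) (hsurj : Function.Surjective (d 0))
    (hex : ∀ i, i + 2 ≤ n → Function.Exact (d (i + 1)) (d i)) : ExtPerp X (W 0) := by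
  obtain rfl | hn := Nat.eq_zero_or_pos n
  · exact fun i ↦ HasProjectiveDimensionLT.subsingleton X 1 (i + 1) (by lia) _
  have key : ∀ k i, i + k + 1 = n → ∀ j, i ≤ j →
      Subsingleton (Abelian.Ext X (ModuleCat.of R (d i).hom.range) (j + 1)) := by
    intro k
    induction k with
    | zero =>
      intro i hi j hj
      exact subsingleton_abelianExt_X₃ (shortExact_ker_range (d i).hom) X (j + 1)
        (hW (i + 1) (by lia) (by lia) j)
        (HasProjectiveDimensionLT.subsingleton X (n + 1) (j + 1 + 1) (by lia) _)
    | succ k ih =>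
      intro i hi j hj
      refine subsingleton_abelianExt_X₃ (shortExact_ker_range (d i).hom) X (j + 1)
        (hW (i + 1) (by lia) (by lia) j) ?_
      have h := ih (i + 1) (by lia) (j + 1) (by lia)
      rw [← LinearMap.exact_iff.1 (hex i (by lia))] at h
      exact h
  intro j
  have := key (n - 1) 0 (by lia) j (Nat.zero_le j)
  have e : (d 0).hom.range ≃ₗ[R] W 0 :=
    LinearEquiv.ofTop _ (LinearMap.range_eq_top.2 hsurj)
  exact subsingleton_abelianExt_of_retract_right X e.symm.toModuleIso.retract (j + 1)

/-- If `R` has a finite coresolution by modules having `M` in their perpendicular class, then every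
element of `M` is in the image of a map from the first term. -/
lemma exists_extension_of_coresolution (n : ℕ) (Tc : ℕ → ModuleCat.{0} R)
    (g : ∀ i, Tc i ⟶ Tc (i + 1)) (ι : R →ₗ[R] Tc 0) (h1 : Function.Injective ι)
    (h2 : Function.Exact ι (g 0)) (h3 : ∀ i, Function.Exact (g i) (g (i + 1)))
    (h5 : ∀ i, n < i → Subsingleton (Tc i)) (M : ModuleCat.{0} R)
    (hM : ∀ i, i ≤ n → ExtPerp (Tc i) M) (f : R →ₗ[R] M) :
    ∃ h : Tc 0 →ₗ[R] M, h ∘ₗ ι = f := by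
  have key : ∀ k i, n ≤ i + k →
      ∀ j, Subsingleton (Abelian.Ext (ModuleCat.of R (g i).hom.range) M (j + 1)) := by
    intro k
    induction k with
    | zero =>
      intro i hi j
      have := h5 (i + 1) (by lia)
      have h0 : IsZero (ModuleCat.of R (g i).hom.range) :=
        ModuleCat.isZero_of_subsingleton _
      have := h0.hasProjectiveDimensionLT_zero
      exact HasProjectiveDimensionLT.subsingleton _ 0 (j + 1) (by lia) _
    | succ k ih =>
      intro i hi j
      obtain hi' | hi' := le_or_gt n i
      · exact ih i (by lia) j
      have h := subsingleton_abelianExt_X₁_left (shortExact_ker_range (g (i + 1)).hom) M (j + 1)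
        (hM (i + 1) (by lia) j) (ih (i + 1) (by lia) (j + 1))
      rw [← LinearMap.exact_iff.1 (h3 i)]
      exact h
  have hS := shortExact_of_linearMap ι (g 0).hom.rangeRestrict h1
    (by
      rw [LinearMap.exact_iff] at h2 ⊢
      rwa [LinearMap.ker_rangeRestrict]) (g 0).hom.surjective_rangeRestrict
  obtain ⟨h, hh⟩ := exists_extension_of_subsingleton_abelianExt hS M
    (key n 0 (by lia) 0) (ModuleCat.ofHom f)
  exact ⟨h.hom, congrArg ModuleCat.Hom.hom hh⟩

end Perpendicular

section Generation

variable {R : Type} [Ring R]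

/-- The canonical map to `M` from the direct sum of copies of `U` indexed by `Hom(U, M)`. -/
noncomputable def canonicalPrecover (U M : Type) [AddCommGroup U] [Module R U] [AddCommGroup M]
    [Module R M] : ((U →ₗ[R] M) →₀ U) →ₗ[R] M :=
  Finsupp.lsum ℕ fun f ↦ f

lemma canonicalPrecover_comp_lsingle (U : Type) {M : Type} [AddCommGroup U] [Module R U]
    [AddCommGroup M] [Module R M] (f : U →ₗ[R] M) :
    canonicalPrecover U M ∘ₗ Finsupp.lsingle f = f := by
  ext u
  simp [canonicalPrecover]

lemma IsSummandOfCopies.range_le_range_canonicalPrecover {U X M : Type} [AddCommGroup U]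
    [Module R U] [AddCommGroup X] [Module R X] [AddCommGroup M] [Module R M]
    (hX : IsSummandOfCopies R U X) (h : X →ₗ[R] M) :
    h.range ≤ (canonicalPrecover (R := R) U M).range := by
  obtain ⟨α, s, r, hsr⟩ := hX
  have : (h ∘ₗ r).range ≤ (canonicalPrecover (R := R) U M).range := by
    rw [LinearMap.range_le_iff_comap, ← top_le_iff, ← Finsupp.iSup_lsingle_range, iSup_le_iff]
    rintro a _ ⟨u, rfl⟩
    exact ⟨Finsupp.single (h ∘ₗ r ∘ₗ Finsupp.lsingle a) u,
      LinearMap.congr_fun (canonicalPrecover_comp_lsingle U (h ∘ₗ r ∘ₗ Finsupp.lsingle a)) u⟩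
  refine le_trans ?_ this
  rintro _ ⟨x, rfl⟩
  exact ⟨s x, congrArg h (LinearMap.congr_fun hsr x)⟩

lemma extPerp_ker_canonicalPrecover {U : Type} [AddCommGroup U] [Module R U]
    (hU : ∀ α : Type, ExtPerp (ModuleCat.of R U) (ModuleCat.of R (α →₀ U)))
    {M : ModuleCat.{0} R} (hM : ExtPerp (ModuleCat.of R U) M)
    (hsurj : Function.Surjective (canonicalPrecover (R := R) U M)) :
    ExtPerp (ModuleCat.of R U) (ModuleCat.of R (canonicalPrecover (R := R) U M).ker) := by
  have hS := shortExact_of_linearMap _ _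
    (canonicalPrecover (R := R) U M).ker.injective_subtype
    (LinearMap.exact_subtype_ker_map _) hsurj
  rintro (_ | i)
  · exact subsingleton_abelianExt_one_X₁ hS _ (hU _ 0) fun f ↦
      ⟨ModuleCat.ofHom (Finsupp.lsingle f.hom),
        ModuleCat.hom_ext (canonicalPrecover_comp_lsingle U f.hom)⟩
  · exact subsingleton_abelianExt_X₁ hS _ (i + 1) (hU _ (i + 1)) (hM i)

section Resolution

variable {U : Type} [AddCommGroup U] [Module R U] {C : ModuleCat.{0} R → Prop}
  (hker : ∀ M, C M → C (ModuleCat.of R (canonicalPrecover (R := R) U M).ker))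

/-- The iterated kernels of canonical precovers. -/
noncomputable def precoverSyzygy (M : {M // C M}) : ℕ → {M // C M}
  | 0 => M
  | i + 1 => ⟨_, hker _ (precoverSyzygy M i).2⟩

/-- The terms of the resolution obtained by iterating canonical precovers, with `M` in degree
`0`. -/
noncomputable def precoverResolution (M : {M // C M}) : ℕ → ModuleCat.{0} R
  | 0 => M.1
  | i + 1 => ModuleCat.of R ((U →ₗ[R] (precoverSyzygy hker M i).1) →₀ U)

/-- The differentials of the resolution obtained by iterating canonical precovers. -/
noncomputable def precoverResolutionD (M : {M // C M}) :
    ∀ i, precoverResolution hker M (i + 1) ⟶ precoverResolution hker M i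
  | 0 => ModuleCat.ofHom (canonicalPrecover (R := R) U M.1)
  | i + 1 => ModuleCat.ofHom (Submodule.subtype _ ∘ₗ
      canonicalPrecover (R := R) U (precoverSyzygy hker M (i + 1)).1)

/-- A class of modules generated by `U` and closed under kernels of canonical precovers is contained
in `Gen_n(U)`. -/
lemma GenN.of_closed_ker_canonicalPrecover
    (hker : ∀ M, C M → C (ModuleCat.of R (canonicalPrecover (R := R) U M).ker))
    (hsurj : ∀ M : ModuleCat.{0} R, C M → Function.Surjective (canonicalPrecover (R := R) U M))
    (n : ℕ) {M : ModuleCat.{0} R} (hM : C M) : GenN R n U M := by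
  refine ⟨precoverResolution hker ⟨M, hM⟩, precoverResolutionD hker ⟨M, hM⟩, rfl, ?_, ?_, ?_⟩
  · rintro (_ | i) hi -
    · lia
    · exact ⟨_, ⟨Iso.refl _⟩⟩
  · exact hsurj M hM
  · have hex (i : ℕ) (x) :
        canonicalPrecover (R := R) U (precoverSyzygy hker ⟨M, hM⟩ i).1 x = 0 ↔
          x ∈ Set.range (precoverResolutionD hker ⟨M, hM⟩ (i + 1)) := by
      refine ⟨fun hx ↦ ?_, ?_⟩
      · obtain ⟨y, hy⟩ := hsurj _ (precoverSyzygy hker ⟨M, hM⟩ (i + 1)).2 ⟨x, hx⟩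
        exact ⟨y, congrArg Subtype.val hy⟩
      · rintro ⟨y, rfl⟩
        exact (canonicalPrecover (R := R) U (precoverSyzygy hker ⟨M, hM⟩ (i + 1)).1 y).2
    rintro (_ | i) - x
    · exact hex 0 x
    · exact Iff.trans Submodule.coe_eq_zero (hex (i + 1) x)

end Resolution

lemma genN_of_extPerp {U : Type} [AddCommGroup U] [Module R U]
    (hU : ∀ α : Type, ExtPerp (ModuleCat.of R U) (ModuleCat.of R (α →₀ U)))
    (m : ℕ) (Tc : ℕ → ModuleCat.{0} R)
    (g : ∀ i, Tc i ⟶ Tc (i + 1)) (ι : R →ₗ[R] Tc 0) (h1 : Function.Injective ι)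
    (h2 : Function.Exact ι (g 0)) (h3 : ∀ i, Function.Exact (g i) (g (i + 1)))
    (h4 : ∀ i, i ≤ m → IsSummandOfCopies R U (Tc i))
    (h5 : ∀ i, m < i → Subsingleton (Tc i)) (n : ℕ) {M : ModuleCat.{0} R}
    (hM : ExtPerp (ModuleCat.of R U) M) : GenN R n U M := by
  have hsurj (M : ModuleCat.{0} R) (hM : ExtPerp (ModuleCat.of R U) M) :
      Function.Surjective (canonicalPrecover (R := R) U M) := by
    intro x
    obtain ⟨h, hh⟩ := exists_extension_of_coresolution m Tc g ι h1 h2 h3 h5 M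
      (fun i hi ↦ (h4 i hi).extPerp hM) (LinearMap.toSpanSingleton R M x)
    exact (h4 0 (Nat.zero_le m)).range_le_range_canonicalPrecover h
      ⟨ι 1, by simpa using LinearMap.congr_fun hh 1⟩
  exact GenN.of_closed_ker_canonicalPrecover
    (fun M hM ↦ extPerp_ker_canonicalPrecover hU hM (hsurj M hM)) hsurj n hM

lemma GenN.extPerp {X : ModuleCat.{0} R} {n : ℕ} [HasProjectiveDimensionLT X (n + 1)] {U : Type}
    [AddCommGroup U] [Module R U] (hU : ∀ α : Type, ExtPerp X (ModuleCat.of R (α →₀ U)))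
    {M : ModuleCat.{0} R} (hM : GenN R n U M) : ExtPerp X M := by
  obtain ⟨W, d, rfl, hW, hsurj, hex⟩ := hM
  refine extPerp_of_exact W d (fun i hi hin j ↦ ?_) hsurj hex
  obtain ⟨α, ⟨e⟩⟩ := hW i hi hin
  have := hU α j
  exact subsingleton_abelianExt_of_retract_right X e.retract (j + 1)

end Generation

section Summands

variable {R : Type} [Ring R] {T X Y : Type} [AddCommGroup T] [Module R T] [AddCommGroup X]
  [Module R X] [AddCommGroup Y] [Module R Y]

lemma IsSummandOfCopies.of_retract (h : IsSummandOfCopies R T X) (s : Y →ₗ[R] X) (r : X →ₗ[R] Y)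
    (hrs : r ∘ₗ s = LinearMap.id) : IsSummandOfCopies R T Y := by
  obtain ⟨α, s', r', h'⟩ := h
  refine ⟨α, s' ∘ₗ s, r ∘ₗ r', ?_⟩
  rw [LinearMap.comp_assoc, ← LinearMap.comp_assoc s, h', LinearMap.id_comp, hrs]

variable (R T) in
lemma isSummandOfCopies_finsupp (α : Type) : IsSummandOfCopies R T (α →₀ T) :=
  ⟨α, LinearMap.id, LinearMap.id, rfl⟩

variable (R T) in
lemma isSummandOfCopies_self : IsSummandOfCopies R T T :=
  (isSummandOfCopies_finsupp R T Unit).of_retract (Finsupp.lsingle ()) (Finsupp.lapply ())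
    (by ext; simp)

lemma IsSummandOfCopies.finsupp (h : IsSummandOfCopies R T X) (β : Type) :
    IsSummandOfCopies R T (β →₀ X) := by
  obtain ⟨α, s, r, h⟩ := h
  refine ⟨β × α, (Finsupp.curryLinearEquiv R).symm.toLinearMap ∘ₗ Finsupp.mapRange.linearMap s,
    Finsupp.mapRange.linearMap r ∘ₗ (Finsupp.curryLinearEquiv R).toLinearMap, ?_⟩
  ext b x : 2
  simpa using congrArg (Finsupp.single b) (LinearMap.congr_fun h x)

lemma IsSummandOfCopies.prod (hX : IsSummandOfCopies R T X) (hY : IsSummandOfCopies R T Y) :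
    IsSummandOfCopies R T (X × Y) := by
  obtain ⟨α, s, r, h⟩ := hX
  obtain ⟨β, s', r', h'⟩ := hY
  refine ⟨α ⊕ β, (Finsupp.sumFinsuppLEquivProdFinsupp R).symm.toLinearMap ∘ₗ s.prodMap s',
    r.prodMap r' ∘ₗ (Finsupp.sumFinsuppLEquivProdFinsupp R).toLinearMap, ?_⟩
  refine LinearMap.ext fun x ↦ ?_
  simpa using Prod.ext (LinearMap.congr_fun h x.1) (LinearMap.congr_fun h' x.2)

lemma IsSummandOfCopies.pi {n : ℕ} {Z : Fin n → Type} [∀ j, AddCommGroup (Z j)]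
    [∀ j, Module R (Z j)] (h : ∀ j, IsSummandOfCopies R T (Z j)) :
    IsSummandOfCopies R T (Π j, Z j) := by
  choose α s r h using h
  refine ⟨Σ j, α j, (Finsupp.sigmaFinsuppLEquivPiFinsupp R).symm.toLinearMap ∘ₗ
      LinearMap.pi fun j ↦ s j ∘ₗ LinearMap.proj j,
    (LinearMap.pi fun j ↦ r j ∘ₗ LinearMap.proj j) ∘ₗ
      (Finsupp.sigmaFinsuppLEquivPiFinsupp R).toLinearMap, ?_⟩
  refine LinearMap.ext fun x ↦ funext fun j ↦ ?_
  simpa using LinearMap.congr_fun (h j) (x j)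

lemma isSummandOfFinCopies_of_retract (s : X →ₗ[R] T) (r : T →ₗ[R] X)
    (hrs : r ∘ₗ s = LinearMap.id) : IsSummandOfFinCopies R T X :=
  ⟨1, LinearMap.pi fun _ ↦ s, r ∘ₗ LinearMap.proj 0, hrs⟩

lemma isSummandOfFinCopies_prod_of_retract (s : X →ₗ[R] T) (r : T →ₗ[R] X)
    (hrs : r ∘ₗ s = LinearMap.id) (s' : Y →ₗ[R] T) (r' : T →ₗ[R] Y)
    (hrs' : r' ∘ₗ s' = LinearMap.id) : IsSummandOfFinCopies R T (X × Y) := by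
  refine ⟨2, LinearMap.pi ![s ∘ₗ LinearMap.fst R X Y, s' ∘ₗ LinearMap.snd R X Y],
    (r ∘ₗ LinearMap.proj 0).prod (r' ∘ₗ LinearMap.proj 1), LinearMap.ext fun x ↦ ?_⟩
  exact Prod.ext (LinearMap.congr_fun hrs x.1) (LinearMap.congr_fun hrs' x.2)

end Summands

section ProjectiveResolution

universe v u

variable {C : Type u} [Category.{v} C] [Abelian C]

/-- A chain complex of projectives, exact in positive degrees, together with an augmentation
identifying its cokernel in degree `0`, is a projective resolution. -/
noncomputable def projectiveResolutionOfAugmentation {Z : C} (K : ChainComplex C ℕ)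
    (hK : ∀ i, Projective (K.X i)) (p : K.X 0 ⟶ Z) (hp : K.d 1 0 ≫ p = 0) (hp' : Epi p)
    (hexact : (ShortComplex.mk _ _ hp).Exact) (hexactAt : ∀ i, K.ExactAt (i + 1)) :
    ProjectiveResolution Z where
  complex := K
  projective := hK
  π := (ChainComplex.toSingle₀Equiv _ _).symm ⟨p, hp⟩
  quasiIso := ⟨fun i ↦ by
    cases i
    · rw [ChainComplex.quasiIsoAt₀_iff, ShortComplex.quasiIso_iff_of_zeros']
      · refine (ShortComplex.exact_and_epi_g_iff_of_iso ?_).2 ⟨hexact, hp'⟩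
        exact ShortComplex.isoMk (Iso.refl _) (Iso.refl _) (Iso.refl _)
          ((Category.id_comp _).trans (Category.comp_id _).symm)
          ((Category.id_comp _).trans
            ((ChainComplex.toSingle₀Equiv_symm_apply_f_zero p hp).symm.trans
              (Category.comp_id _).symm))
      all_goals first | rfl | exact K.shape 0 0 (by simp)
    · rw [quasiIsoAt_iff_exactAt']
      · apply hexactAt
      · apply ChainComplex.exactAt_succ_single_obj⟩

/-- Splicing a projective resolution of `S.X₁` with a short exact sequence whose middle term is
projective. -/
noncomputable def spliceResolution {S : ShortComplex C} (hS : S.ShortExact) (hS₂ : Projective S.X₂)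
    (Q : ProjectiveResolution S.X₁) : ProjectiveResolution S.X₃ :=
  let p : Q.complex.X 0 ⟶ S.X₁ := Q.π.f 0
  have hp : Q.complex.d 1 0 ≫ p = 0 := Q.complex_d_comp_π_f_zero
  have hpe : Epi p := inferInstanceAs (Epi (Q.π.f 0))
  have hz : (p ≫ S.f) ≫ S.g = 0 := by rw [Category.assoc, S.zero, comp_zero]
  projectiveResolutionOfAugmentation
    (Q.complex.augment (p ≫ S.f) (by rw [reassoc_of% hp, zero_comp]))
    (fun
      | 0 => hS₂
      | i + 1 => Q.projective i)
    S.g hz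
    hS.epi_g
    (by
      let φ : ShortComplex.mk (p ≫ S.f) S.g (by simp) ⟶ S :=
        { τ₁ := p, τ₂ := 𝟙 _, τ₃ := 𝟙 _ }
      have : Epi φ.τ₁ := hpe
      have : IsIso φ.τ₂ := inferInstanceAs (IsIso (𝟙 S.X₂))
      have : Mono φ.τ₃ := inferInstanceAs (Mono (𝟙 S.X₃))
      exact (ShortComplex.exact_iff_of_epi_of_isIso_of_mono φ).2 hS.exact)
    (by
      intro i
      rw [HomologicalComplex.exactAt_iff' _ (i + 2) (i + 1) i (by simp) (by simp)]
      cases i with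
      | zero =>
        let φ : ShortComplex.mk (Q.complex.d 1 0) p hp ⟶
            ShortComplex.mk (Q.complex.d 1 0) (p ≫ S.f) (by rw [reassoc_of% hp, zero_comp]) :=
          { τ₁ := 𝟙 _, τ₂ := 𝟙 _, τ₃ := S.f }
        have : Epi φ.τ₁ := inferInstanceAs (Epi (𝟙 (Q.complex.X 1)))
        have : IsIso φ.τ₂ := inferInstanceAs (IsIso (𝟙 (Q.complex.X 0)))
        have : Mono φ.τ₃ := hS.mono_f
        exact (ShortComplex.exact_iff_of_epi_of_isIso_of_mono φ).1 Q.exact₀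
      | succ i => exact Q.exact_succ i)

lemma exists_projectiveResolution_of_hasProjectiveDimensionLT [EnoughProjectives C] (M : C) (n : ℕ)
    [HasProjectiveDimensionLT M (n + 1)] :
    ∃ P : ProjectiveResolution M, ∀ i, n < i → IsZero (P.complex.X i) := by
  induction n generalizing M with
  | zero =>
    have : Projective M := projective_iff_hasProjectiveDimensionLT_one.2 ‹_›
    refine ⟨ProjectiveResolution.self M, fun i hi ↦ ?_⟩
    exact HomologicalComplex.isZero_single_obj_X (ComplexShape.down ℕ) 0 M i (by lia)
  | succ n ih =>
    let S := ShortComplex.mk _ _ (kernel.condition (Projective.π M))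
    have hS : S.ShortExact :=
      { exact := ShortComplex.exact_of_f_is_kernel _ (kernelIsKernel S.g) }
    have hS₂ : Projective S.X₂ := inferInstanceAs (Projective (Projective.over M))
    have := (hS.hasProjectiveDimensionLT_X₃_iff n hS₂).1 ‹_›
    obtain ⟨Q, hQ⟩ := ih S.X₁
    refine ⟨spliceResolution hS hS₂ Q, fun i hi ↦ ?_⟩
    obtain ⟨i, rfl⟩ : ∃ j, i = j + 1 := ⟨i - 1, by lia⟩
    exact hQ i (by lia)

end ProjectiveResolution

section Coresolution

variable {R : Type} [Ring R]

/-- Each `Z i` with `i ≤ n` is a direct summand of `Z_0 ⊕ Z_1^(ω) ⊕ ⋯ ⊕ Z_n^(ω)`. -/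
lemma exists_retract_prod_pi_finsupp (Z : ℕ → Type) [∀ i, AddCommGroup (Z i)]
    [∀ i, Module R (Z i)] (n : ℕ) {i : ℕ} (hi : i ≤ n) :
    ∃ (s : Z i →ₗ[R] Z 0 × Π j : Fin n, (ℕ →₀ Z (j + 1)))
      (r : (Z 0 × Π j : Fin n, (ℕ →₀ Z (j + 1))) →ₗ[R] Z i), r ∘ₗ s = LinearMap.id := by
  cases i with
  | zero => exact ⟨LinearMap.inl R _ _, LinearMap.fst R _ _, rfl⟩
  | succ i =>
    let j : Fin n := ⟨i, hi⟩
    refine ⟨LinearMap.inr R _ _ ∘ₗ LinearMap.single R (fun j : Fin n ↦ ℕ →₀ Z (j + 1)) j ∘ₗ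
        Finsupp.lsingle 0,
      Finsupp.lapply (R := R) (0 : ℕ) ∘ₗ
        LinearMap.proj (φ := fun j : Fin n ↦ ℕ →₀ Z (j + 1)) j ∘ₗ LinearMap.snd R _ _,
      LinearMap.ext fun x ↦ ?_⟩
    change Pi.single (M := fun j : Fin n ↦ ℕ →₀ Z (j + 1)) j (Finsupp.single 0 x) j 0 = x
    rw [Pi.single_eq_same, Finsupp.single_eq_same]

/-- A coresolution remains exact after adding the identity of `X` to its first map. -/
lemma exists_coresolution_prod (Tc : ℕ → ModuleCat R) (g : ∀ i, Tc i ⟶ Tc (i + 1))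
    (ι : R →ₗ[R] Tc 0) (h1 : Function.Injective ι) (h2 : Function.Exact ι (g 0))
    (h3 : ∀ i, Function.Exact (g i) (g (i + 1))) (X : Type) [AddCommGroup X] [Module R X] :
    ∃ (W : ℕ → ModuleCat R) (d : ∀ i, W i ⟶ W (i + 1)) (ι' : R →ₗ[R] W 0),
      Function.Injective ι' ∧ Function.Exact ι' (d 0) ∧
      (∀ i, Function.Exact (d i) (d (i + 1))) ∧
      W 0 = ModuleCat.of R (Tc 0 × X) ∧ W 1 = ModuleCat.of R (Tc 1 × X) ∧
      ∀ i, W (i + 2) = Tc (i + 2) := by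
  let W : ℕ → ModuleCat R := fun
    | 0 => ModuleCat.of R (Tc 0 × X)
    | 1 => ModuleCat.of R (Tc 1 × X)
    | i + 2 => Tc (i + 2)
  let d : ∀ i, W i ⟶ W (i + 1) := fun
    | 0 => ModuleCat.ofHom ((g 0).hom.prodMap LinearMap.id)
    | 1 => ModuleCat.ofHom ((g 1).hom ∘ₗ LinearMap.fst R (Tc 1) X)
    | i + 2 => g (i + 2)
  refine ⟨W, d, LinearMap.inl R (Tc 0) X ∘ₗ ι, LinearMap.inl_injective.comp h1, ?_, ?_, rfl, rfl,
    fun _ ↦ rfl⟩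
  · rintro ⟨a, x⟩
    change ((g 0).hom a, x) = 0 ↔ ∃ r, (ι r, (0 : X)) = (a, x)
    simp only [Prod.mk_eq_zero, Prod.mk.injEq, h2 a, Set.mem_range, exists_and_right,
      eq_comm (a := x)]
  · rintro (_ | _ | i)
    · rintro ⟨a, x⟩
      change (g 1).hom a = 0 ↔ ∃ y : Tc 0 × X, ((g 0).hom y.1, y.2) = (a, x)
      refine (h3 0 a).trans ⟨?_, ?_⟩
      · rintro ⟨b, rfl⟩
        exact ⟨(b, x), rfl⟩
      · rintro ⟨y, hy⟩
        exact ⟨y.1, congrArg Prod.fst hy⟩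
    · intro a
      change (g 2).hom a = 0 ↔ ∃ y : Tc 1 × X, (g 1).hom y.1 = a
      refine (h3 1 a).trans ⟨?_, ?_⟩
      · rintro ⟨b, rfl⟩
        exact ⟨(b, 0), rfl⟩
      · rintro ⟨y, hy⟩
        exact ⟨y.1, hy⟩
    · exact h3 (i + 2)

end Coresolution

/-- For any `n`-tilting module `T` with a given `Add(T)`-coresolution
`0 → R → T_0 → ⋯ → T_n → 0`, the module `T' = T_0 ⊕ T_1^{(ω)} ⊕ ⋯ ⊕ T_n^{(ω)}`
admits an exact coresolution `0 → R → W_0 → ⋯ → W_n → 0` with terms countable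
direct sums of the `T_i`'s, is a good `n`-tilting module, and is equivalent to `T`,
i.e. `Gen_n(T') = Gen_n(T)`. -/
theorem statement8 (R : Type) [Ring R] (n : ℕ) (T : Type) [AddCommGroup T] [Module R T]
    (hT : IsNTilting R n (ModuleCat.of R T))
    (Tc : ℕ → ModuleCat R) (g : ∀ i, Tc i ⟶ Tc (i + 1)) (ι : R →ₗ[R] Tc 0)
    (h1 : Function.Injective ι) (h2 : Function.Exact ι (g 0))
    (h3 : ∀ i, Function.Exact (g i) (g (i + 1)))
    (h4 : ∀ i, i ≤ n → IsSummandOfCopies R T (Tc i))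
    (h5 : ∀ i, n < i → Subsingleton (Tc i)) :
    (∃ (W : ℕ → ModuleCat R) (d : ∀ i, W i ⟶ W (i + 1)) (ι' : R →ₗ[R] W 0),
      Function.Injective ι' ∧ Function.Exact ι' (d 0) ∧
      (∀ i, Function.Exact (d i) (d (i + 1))) ∧
      Nonempty (W 0 ≅ ModuleCat.of R (Tc 0 × Π j : Fin n, (ℕ →₀ Tc (j + 1)))) ∧
      (∀ i, i ≤ n → IsSummandOfCopies R T (W i)) ∧
      (∀ i, n < i → Subsingleton (W i))) ∧
    IsGoodNTilting R n (ModuleCat.of R (Tc 0 × Π j : Fin n, (ℕ →₀ Tc (j + 1)))) ∧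
    (∀ M : ModuleCat R,
      GenN R n T M ↔ GenN R n (Tc 0 × Π j : Fin n, (ℕ →₀ Tc (j + 1))) M) := by
  let X : Type := Π j : Fin n, (ℕ →₀ Tc (j + 1))
  have hTc (i : ℕ) (hi : i ≤ n) : ∃ (s : Tc i →ₗ[R] Tc 0 × X) (r : Tc 0 × X →ₗ[R] Tc i),
      r ∘ₗ s = LinearMap.id := exists_retract_prod_pi_finsupp (fun i ↦ Tc i) n hi
  have hX : IsSummandOfCopies R T X := .pi fun j ↦ (h4 (j + 1) j.2).finsupp ℕ
  have hT' : IsSummandOfCopies R T (Tc 0 × X) := (h4 0 n.zero_le).prod hX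
  have hT'Tc (i : ℕ) (hi : i ≤ n) : IsSummandOfCopies R (Tc 0 × X) (Tc i) := by
    obtain ⟨s, r, hrs⟩ := hTc i hi
    exact (isSummandOfCopies_self R (Tc 0 × X)).of_retract s r hrs
  obtain ⟨P, hP⟩ := hT.t1
  have : HasProjectiveDimensionLT (ModuleCat.of R T) (n + 1) :=
    hasProjectiveDimensionLT_of_projectiveResolution P n hP
  have hTT (α : Type) : ExtPerp (ModuleCat.of R T) (ModuleCat.of R (α →₀ T)) := fun i ↦
    (subsingleton_extRT_iff _ _ i.succ_pos).1 (hT.t2 (i + 1) i.succ_pos α)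
  have hTT' (α : Type) : ExtPerp (ModuleCat.of R T) (ModuleCat.of R (α →₀ Tc 0 × X)) :=
    (hT'.finsupp α).extPerp_right hTT
  have hT'T' (α : Type) :
      ExtPerp (ModuleCat.of R (Tc 0 × X)) (ModuleCat.of R (α →₀ Tc 0 × X)) :=
    hT'.extPerp (hTT' α)
  obtain ⟨W, d, ι', hι', hd0, hd, hW0, hW1, hW2⟩ := exists_coresolution_prod Tc g ι h1 h2 h3 X
  have hWzero (i : ℕ) (hi : n < i) : Subsingleton (W i) := by
    match i with
    | 1 =>
      have : IsEmpty (Fin n) := ⟨fun j ↦ by have := j.2; lia⟩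
      have := h5 1 hi
      rw [hW1]
      exact inferInstanceAs (Subsingleton (Tc 1 × X))
    | i + 2 =>
      rw [hW2]
      exact h5 _ hi
  refine ⟨⟨W, d, ι', hι', hd0, hd, ⟨eqToIso hW0⟩, fun i hi ↦ ?_, hWzero⟩,
    ⟨?_, fun i hi α ↦ ?_, W, d, ι', hι', hd0, hd, fun i hi ↦ ?_, hWzero⟩,
    fun M ↦ ⟨fun hM ↦ ?_, fun hM ↦ ?_⟩⟩
  · match i with
    | 0 => rwa [hW0]
    | 1 => rw [hW1]; exact (h4 1 hi).prod hX
    | i + 2 => rw [hW2]; exact h4 _ hi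
  · have := hT'.hasProjectiveDimensionLT n
    exact exists_projectiveResolution_of_hasProjectiveDimensionLT (ModuleCat.of R (Tc 0 × X)) n
  · obtain ⟨i, rfl⟩ : ∃ j, i = j + 1 := ⟨i - 1, by lia⟩
    exact (subsingleton_extRT_iff _ _ hi).2 (hT'T' α i)
  · match i with
    | 0 =>
      rw [hW0]
      exact isSummandOfFinCopies_of_retract LinearMap.id LinearMap.id rfl
    | 1 =>
      rw [hW1]
      obtain ⟨s, r, hrs⟩ := hTc 1 hi
      exact isSummandOfFinCopies_prod_of_retract s r hrs (LinearMap.inr R (Tc 0) X)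
        (LinearMap.snd R (Tc 0) X) rfl
    | i + 2 =>
      rw [hW2]
      obtain ⟨s, r, hrs⟩ := hTc (i + 2) hi
      exact isSummandOfFinCopies_of_retract s r hrs
  · exact genN_of_extPerp hT'T' n Tc g ι h1 h2 h3 hT'Tc h5 n (hT'.extPerp (hM.extPerp hTT))
  · exact genN_of_extPerp hTT n Tc g ι h1 h2 h3 h4 h5 n (hM.extPerp hTT')
end

section
/- Let T_R be a good n-tilting module with endomorphism ring S. Then Ext^i_S(_S T, _S T) = 0 for all i ≥ 1, where Ext is computed in the category of left S-modules. -/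
open CategoryTheory CategoryTheory.Limits

open Abelian (Ext)

/-- Vanishing of the derived functor `Ext` agrees with vanishing of the Yoneda `Ext`
in positive degrees. -/
theorem subsingleton_extRT_succ_iff_s12 {A : Type} [Ring A] (M N : ModuleCat.{0} A) (n : ℕ) :
    Subsingleton (extRT A (n + 1) M N) ↔ Subsingleton (Ext.{0} M N (n + 1)) := by
  let P := projectiveResolution M
  have hderived : Subsingleton (extRT A (n + 1) M N) ↔
      ∀ f : P.complex.X (n + 1) ⟶ N, P.complex.d (n + 2) (n + 1) ≫ f = 0 →
        ∃ g : P.complex.X n ⟶ N, P.complex.d (n + 1) n ≫ g = f := by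
    rw [← ModuleCat.isZero_iff_subsingleton, extRT, (P.isoExt (n + 1) N).isZero_iff,
      ← HomologicalComplex.exactAt_iff_isZero_homology,
      HomologicalComplex.exactAt_iff' _ n (n + 1) (n + 2) (by simp) (by simp),
      ShortComplex.moduleCat_exact_iff]
    rfl
  rw [hderived]
  constructor
  · intro h
    refine subsingleton_of_forall_eq 0 fun x => ?_
    obtain ⟨f, hf, rfl⟩ := P.extMk_surjective x (n + 2) rfl
    exact (P.extMk_eq_zero_iff f _ rfl hf n rfl).2 (h f hf)
  · intro h f hf
    exact (P.extMk_eq_zero_iff f _ rfl hf n rfl).1 (Subsingleton.elim _ _)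

/-- `Ext` vanishing passes to retracts in the second variable. -/
theorem subsingleton_ext_of_retract_right {A : Type} [Ring A] {M N N' : ModuleCat.{0} A} {n : ℕ}
    (s : N ⟶ N') (r : N' ⟶ N) (hsr : s ≫ r = 𝟙 N) (h : Subsingleton (Ext.{0} M N' n)) :
    Subsingleton (Ext.{0} M N n) := by
  refine subsingleton_of_forall_eq 0 fun x => ?_
  rw [← x.comp_mk₀_id, ← hsr, ← Ext.mk₀_comp_mk₀, ← Ext.comp_assoc_of_second_deg_zero,
    Subsingleton.elim (x.comp (Ext.mk₀ s) (add_zero n)) 0, Ext.zero_comp]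

section Duality

variable {R : Type} [Ring R] {T : Type} [AddCommGroup T] [Module R T]

namespace IsSummandOfFinCopies

variable {X : Type} [AddCommGroup X] [Module R X]

theorem of_subsingleton [Subsingleton X] : IsSummandOfFinCopies R T X :=
  ⟨0, 0, 0, Subsingleton.elim _ _⟩

/-- A summand of `T^k` has `k` coordinate maps to `T` and `k` maps from `T` that reassemble
its elements. -/
theorem exists_sum_eq (h : IsSummandOfFinCopies R T X) :
    ∃ (k : ℕ) (s : Fin k → X →ₗ[R] T) (r : Fin k → T →ₗ[R] X),
      ∀ x, ∑ j, r j (s j x) = x := by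
  obtain ⟨k, s, r, hrs⟩ := h
  refine ⟨k, fun j => LinearMap.proj j ∘ₗ s, fun j => r ∘ₗ LinearMap.single R (fun _ => T) j,
    fun x => ?_⟩
  simp only [LinearMap.comp_apply, LinearMap.proj_apply, LinearMap.single_apply, ← map_sum]
  rw [Finset.univ_sum_single]
  exact LinearMap.congr_fun hrs x

theorem subsingleton_ext (h : IsSummandOfFinCopies R T X) {Y : ModuleCat.{0} R} {n : ℕ}
    (hT : Subsingleton (Ext.{0} (ModuleCat.of R T) Y n)) :
    Subsingleton (Ext.{0} (ModuleCat.of R X) Y n) := by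
  obtain ⟨k, s, r, hsr⟩ := h.exists_sum_eq
  have hid : 𝟙 (ModuleCat.of R X) = ∑ j, ModuleCat.ofHom (s j) ≫ ModuleCat.ofHom (r j) := by
    ext x
    simpa [ModuleCat.hom_sum] using (hsr x).symm
  refine subsingleton_of_forall_eq 0 fun x => ?_
  rw [← x.mk₀_id_comp, hid, Ext.mk₀_sum, Ext.sum_comp]
  refine Finset.sum_eq_zero fun j _ => ?_
  rw [← Ext.mk₀_comp_mk₀_assoc,
    Subsingleton.elim ((Ext.mk₀ (ModuleCat.ofHom (r j))).comp x (zero_add n)) 0, Ext.comp_zero]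

theorem projective_dual (h : IsSummandOfFinCopies R T X) :
    Module.Projective (Module.End R T) (X →ₗ[R] T) := by
  obtain ⟨k, s, r, hsr⟩ := h.exists_sum_eq
  let i : (X →ₗ[R] T) →ₗ[Module.End R T] (Fin k → Module.End R T) :=
    { toFun := fun f j => f ∘ₗ r j
      map_add' := fun _ _ => rfl
      map_smul' := fun _ _ => rfl }
  let p : (Fin k → Module.End R T) →ₗ[Module.End R T] (X →ₗ[R] T) :=
    Fintype.linearCombination (Module.End R T) s
  refine Module.Projective.of_split i p ?_
  ext f x
  have : ∑ j, f (r j (s j x)) = f x := by rw [← map_sum, hsr]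
  simpa [i, p, Fintype.linearCombination_apply] using this

end IsSummandOfFinCopies

/-- The evaluation map of the bidual is surjective. -/
def BidualSurjective (R T X : Type) [Ring R] [AddCommGroup T] [Module R T]
    [AddCommGroup X] [Module R X] : Prop :=
  ∀ φ : (X →ₗ[R] T) →ₗ[Module.End R T] T, ∃ x, ∀ f, φ f = f x

/-- The evaluation map of the bidual is injective. -/
def BidualInjective (R T X : Type) [Ring R] [AddCommGroup T] [Module R T]
    [AddCommGroup X] [Module R X] : Prop :=
  ∀ x : X, (∀ f : X →ₗ[R] T, f x = 0) → x = 0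

namespace IsSummandOfFinCopies

variable {X : Type} [AddCommGroup X] [Module R X]

theorem bidualSurjective (h : IsSummandOfFinCopies R T X) : BidualSurjective R T X := by
  obtain ⟨k, s, r, hsr⟩ := h.exists_sum_eq
  refine fun φ => ⟨∑ j, r j (φ (s j)), fun f => ?_⟩
  have hf : f = ∑ j, (f ∘ₗ r j : Module.End R T) • s j := by
    ext x
    have : ∑ j, f (r j (s j x)) = f x := by rw [← map_sum, hsr]
    simpa using this.symm
  conv_lhs => rw [hf]
  simp

theorem bidualInjective (h : IsSummandOfFinCopies R T X) : BidualInjective R T X := by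
  obtain ⟨k, s, r, hsr⟩ := h.exists_sum_eq
  intro x hx
  rw [← hsr x]
  simp [hx]

end IsSummandOfFinCopies

/-- `K` is `T`-reflexive, all higher `Ext_R(K, T)` vanish, and all higher
`Ext_S(Hom_R(K, T), T)` vanish, where `S = End_R(T)`. -/
structure IsExtReflexive (R T K : Type) [Ring R] [AddCommGroup T] [Module R T]
    [AddCommGroup K] [Module R K] : Prop where
  ext : ∀ m, Subsingleton (Ext.{0} (ModuleCat.of R K) (ModuleCat.of R T) (m + 1))
  ext_dual : ∀ m, Subsingleton (Ext.{0} (ModuleCat.of (Module.End R T) (K →ₗ[R] T))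
    (ModuleCat.of (Module.End R T) T) (m + 1))
  surj : BidualSurjective R T K
  inj : BidualInjective R T K

namespace IsExtReflexive

variable {K X L : Type} [AddCommGroup K] [Module R K] [AddCommGroup X] [Module R X]
  [AddCommGroup L] [Module R L]

theorem of_subsingleton [Subsingleton K] : IsExtReflexive R T K where
  ext m := by
    have : Projective (ModuleCat.of R K) :=
      (ModuleCat.isZero_of_subsingleton _).projective
    exact Ext.subsingleton_of_projective _ _ m
  ext_dual m := by
    have : Subsingleton (K →ₗ[R] T) := ⟨fun f g => by ext x; simp [Subsingleton.elim x 0]⟩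
    have : Projective (ModuleCat.of (Module.End R T) (K →ₗ[R] T)) :=
      (ModuleCat.isZero_of_subsingleton _).projective
    exact Ext.subsingleton_of_projective _ _ m
  surj φ := ⟨0, fun f => by
    rw [map_zero, show f = 0 by ext x; simp [Subsingleton.elim x 0], map_zero]⟩
  inj _ _ := Subsingleton.elim _ _

/-- If `0 → K → X → L → 0` is exact with `X ∈ add(T)` and `L` is Ext-reflexive,
then so is `K`. -/
theorem of_shortExact
    (hT : ∀ m, Subsingleton (Ext.{0} (ModuleCat.of R T) (ModuleCat.of R T) (m + 1)))
    (i : K →ₗ[R] X) (p : X →ₗ[R] L) (hi : Function.Injective i) (hip : Function.Exact i p)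
    (hp : Function.Surjective p) (hX : IsSummandOfFinCopies R T X) (hL : IsExtReflexive R T L) :
    IsExtReflexive R T K := by
  let C : ShortComplex (ModuleCat.{0} R) :=
    ShortComplex.mk (ModuleCat.ofHom i) (ModuleCat.ofHom p)
      (by ext x; exact hip.apply_apply_eq_zero x)
  have hC : C.ShortExact := ModuleCat.shortComplex_shortExact C hip hi hp
  have hlift : ∀ f : K →ₗ[R] T, ∃ g : X →ₗ[R] T, g ∘ₗ i = f := by
    intro f
    have := hL.ext 0
    obtain ⟨x, hx⟩ := Ext.contravariant_sequence_exact₁ hC (Y := ModuleCat.of R T)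
      (Ext.mk₀ (ModuleCat.ofHom f)) (add_zero 1) (this.elim _ _)
    obtain ⟨g, rfl⟩ := (Ext.mk₀_bijective _ _).2 x
    rw [Ext.mk₀_comp_mk₀] at hx
    exact ⟨g.hom, congrArg ModuleCat.Hom.hom ((Ext.mk₀_bijective _ _).1 hx)⟩
  have hinj : BidualInjective R T K := fun x hx =>
    hi (by rw [map_zero]; exact hX.bidualInjective _ fun f => hx (f ∘ₗ i))
  refine ⟨fun m => ?_, fun m => ?_, fun φ => ?_, hinj⟩
  · refine subsingleton_of_forall_eq 0 fun x => ?_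
    obtain ⟨y, rfl⟩ := Ext.contravariant_sequence_exact₁ hC (Y := ModuleCat.of R T) x
      (add_comm 1 (m + 1)) ((hL.ext (m + 1)).elim _ _)
    rw [(hX.subsingleton_ext (hT m)).elim y 0, Ext.comp_zero]
  · let D : ShortComplex (ModuleCat.{0} (Module.End R T)) :=
      ShortComplex.mk (ModuleCat.ofHom (LinearMap.lcomp (Module.End R T) T p))
        (ModuleCat.ofHom (LinearMap.lcomp (Module.End R T) T i))
        (by ext f x; simp [hip.apply_apply_eq_zero x])
    have hD : D.ShortExact := by
      refine ModuleCat.shortComplex_shortExact D ?_ ?_ ?_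
      · intro f
        constructor
        · intro hf
          have hker : LinearMap.ker p ≤ LinearMap.ker f := fun x hx => by
            obtain ⟨k, rfl⟩ := (hip x).1 hx
            exact LinearMap.congr_fun hf k
          refine ⟨(LinearMap.ker p).liftQ f hker ∘ₗ
            (p.quotKerEquivOfSurjective hp).symm.toLinearMap, ?_⟩
          refine LinearMap.ext fun x => ?_
          have : (p.quotKerEquivOfSurjective hp).symm (p x) = (LinearMap.ker p).mkQ x := by
            rw [LinearEquiv.symm_apply_eq]; rfl
          exact (congrArg ((LinearMap.ker p).liftQ f hker) this).trans (by simp)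
        · rintro ⟨g, rfl⟩
          exact LinearMap.ext fun k => (congrArg g (hip.apply_apply_eq_zero k)).trans (map_zero g)
      · intro f g hfg
        refine LinearMap.ext fun l => ?_
        obtain ⟨x, rfl⟩ := hp l
        exact LinearMap.congr_fun hfg x
      · exact hlift
    have : Projective D.X₂ :=
      (IsProjective.iff_projective _).1 hX.projective_dual
    refine subsingleton_of_forall_eq 0 fun x => ?_
    obtain ⟨y, rfl⟩ := Ext.contravariant_sequence_exact₃ hD _ x (Ext.eq_zero_of_projective _)
      (add_comm 1 m)
    cases m with
    | succ m => rw [(hL.ext_dual m).elim y 0, Ext.comp_zero]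
    | zero =>
      obtain ⟨φ, rfl⟩ := (Ext.mk₀_bijective _ _).2 y
      obtain ⟨l, hl⟩ := hL.surj φ.hom
      obtain ⟨x, rfl⟩ := hp l
      have hφ : φ = D.f ≫ ModuleCat.ofHom (LinearMap.applyₗ' (Module.End R T) x) := by
        ext f
        exact hl f
      rw [hφ, ← Ext.mk₀_comp_mk₀, ShortComplex.ShortExact.extClass_comp_assoc]
  · obtain ⟨x, hx⟩ := hX.bidualSurjective (φ ∘ₗ LinearMap.lcomp (Module.End R T) T i)
    have hpx : p x = 0 := hL.inj _ fun f => by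
      have h0 : (f ∘ₗ p) ∘ₗ i = 0 := by ext k; simp [hip.apply_apply_eq_zero k]
      have : φ ((f ∘ₗ p) ∘ₗ i) = f (p x) := hx (f ∘ₗ p)
      rw [← this, h0, map_zero]
    obtain ⟨k, rfl⟩ := (hip x).1 hpx
    refine ⟨k, fun f => ?_⟩
    obtain ⟨g, rfl⟩ := hlift f
    exact hx g

end IsExtReflexive

end Duality

/-- If `T` is a good `n`-tilting module with `S = End_R(T)`, then
`Ext^i_S(T, T) = 0` for all `i ≥ 1` in the category of (left) `S`-modules. -/
theorem statement12 (R : Type) [Ring R] (n : ℕ) (T : Type) [AddCommGroup T] [Module R T]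
    (hT : IsGoodNTilting R n (ModuleCat.of R T)) (i : ℕ) (hi : 1 ≤ i) :
    Subsingleton (extRT (Module.End R T) i
      (ModuleCat.of (Module.End R T) T) (ModuleCat.of (Module.End R T) T)) := by
  obtain ⟨m, rfl⟩ : ∃ m, i = m + 1 := ⟨i - 1, by lia⟩
  have hTT : ∀ m, Subsingleton (Ext.{0} (ModuleCat.of R T) (ModuleCat.of R T) (m + 1)) := by
    intro m
    refine subsingleton_ext_of_retract_right
      (ModuleCat.ofHom (Finsupp.lsingle (R := R) (M := T) ()))
      (ModuleCat.ofHom (Finsupp.lapply (R := R) (M := T) ())) ?_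
      ((subsingleton_extRT_succ_iff_s12 _ _ m).1 (hT.t2 (m + 1) m.succ_pos Unit))
    ext x
    simp
  obtain ⟨Tc, g, ι, hι, hι0, hg, hadd, hzero⟩ := hT.t3'
  have hTc : ∀ j, IsSummandOfFinCopies R T (Tc j) := fun j =>
    (le_or_gt j n).elim (hadd j) fun hj =>
      have := hzero j hj
      .of_subsingleton
  -- the corestriction of `g j` to the next kernel
  let q : ∀ j, Tc j →ₗ[R] LinearMap.ker (g (j + 1)).hom := fun j =>
    (g j).hom.codRestrict _ fun x => (hg j).apply_apply_eq_zero x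
  have hq : ∀ j, Function.Surjective (q j) := by
    rintro j ⟨y, hy⟩
    obtain ⟨x, hx⟩ := (hg j y).1 hy
    exact ⟨x, Subtype.ext hx⟩
  have hqz : ∀ j x, q j x = 0 ↔ (g j).hom x = 0 := fun j x => Subtype.ext_iff
  have hker : ∀ d j, n < j + d → IsExtReflexive R T (LinearMap.ker (g j).hom) := by
    intro d
    induction d with
    | zero =>
      intro j hj
      have := hzero j hj
      exact .of_subsingleton
    | succ d ih =>
      intro j hj
      refine .of_shortExact hTT (Submodule.subtype _) (q j) (Submodule.subtype_injective _) ?_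
        (hq j) (hTc j) (ih (j + 1) (by lia))
      intro x
      simp [hqz]
  have hR : IsExtReflexive R T R :=
    .of_shortExact hTT ι (q 0) hι (fun x => (hqz 0 x).trans (hι0 x)) (hq 0) (hTc 0)
      (hker n 1 (by lia))
  rw [subsingleton_extRT_succ_iff_s12]
  let e : ModuleCat.of (Module.End R T) (R →ₗ[R] T) ≅ ModuleCat.of (Module.End R T) T :=
    (LinearMap.ringLmapEquivSelf R (Module.End R T) T).toModuleIso
  have := hR.ext_dual m
  refine subsingleton_of_forall_eq 0 fun x => ?_
  rw [← x.mk₀_id_comp, ← e.inv_hom_id, ← Ext.mk₀_comp_mk₀_assoc,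
    Subsingleton.elim ((Ext.mk₀ e.hom).comp x (zero_add _)) 0, Ext.comp_zero]
end
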